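/- Suppose Assumption 1 (mutual incoherence) holds with constant α ∈ (0,1]. Let Ω̃ be the restricted estimator, Ψ := Ω̃ − Ω̄, R(Ψ) := Ω̃^{-1} − Σ̄ + Σ̄ΨΣ̄, and let Z̃ ∈ ℝ^{N×N} satisfy the stationarity equation Σ_{k=1}^K T^{(k)}(Σ̂^{(k)} − Ω̃^{-1}) + λZ̃ = 0 together with ‖Z̃_S‖_∞ ≤ 1. If T‖R(Ψ)‖_∞ ≤ αλ/8 and ‖Σ_{k=1}^K T^{(k)}W^{(k)}‖_∞ ≤ αλ/8, then ‖Z̃_{S^c}‖_∞ ≤ 1 − α/2 < 1, i.e. the strict dual feasibility condition holds. -/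

import Mathlib

open Matrix BigOperators
open scoped Classical

/-- Frobenius inner product `⟨A,B⟩ = ∑_{i,j} A_{ij} B_{ij}`. -/
noncomputable def frobInner {N : ℕ} (A B : Matrix (Fin N) (Fin N) ℝ) : ℝ :=
  ∑ i, ∑ j, A i j * B i j

/-- Entrywise ℓ₁ norm `‖A‖₁ = ∑_{i,j} |A_{ij}|`. -/
noncomputable def matL1Norm {N : ℕ} (A : Matrix (Fin N) (Fin N) ℝ) : ℝ :=
  ∑ i, ∑ j, |A i j|

/-- Entrywise ℓ∞ norm `‖A‖_∞ = max_{i,j} |A_{ij}|`. -/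
noncomputable def elemInf {N : ℕ} (A : Matrix (Fin N) (Fin N) ℝ) : ℝ :=
  ⨆ p : Fin N × Fin N, |A p.1 p.2|

/-- ℓ∞ operator norm `|||A|||_∞ = max_i ∑_j |A_{ij}|`. -/
noncomputable def opInf {m n : Type*} [Fintype n] (A : Matrix m n ℝ) : ℝ :=
  ⨆ i, ∑ j, |A i j|

/-- Support of a matrix: the set of indices of nonzero entries. -/
def matSupp {N : ℕ} (A : Matrix (Fin N) (Fin N) ℝ) : Set (Fin N × Fin N) :=
  {p | A p.1 p.2 ≠ 0}

/-- The Kronecker product with pair indices: `[A ⊗ B]_{(i,k),(j,l)} = A_{ij} B_{kl}`. -/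
noncomputable def kron {N : ℕ} (A B : Matrix (Fin N) (Fin N) ℝ) :
    Matrix (Fin N × Fin N) (Fin N × Fin N) ℝ :=
  fun p q => A p.1 q.1 * B p.2 q.2

/-- The submatrix `Γ̄_{SS}` of `Γ̄ = Σ̄ ⊗ Σ̄`. -/
noncomputable def gammaSS {N : ℕ} (Sig : Matrix (Fin N) (Fin N) ℝ)
    (S : Set (Fin N × Fin N)) : Matrix ↥S ↥S ℝ :=
  fun p q => kron Sig Sig p.val q.val

/-- The submatrix `Γ̄_{S^c S}` of `Γ̄ = Σ̄ ⊗ Σ̄`. -/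
noncomputable def gammaScS {N : ℕ} (Sig : Matrix (Fin N) (Fin N) ℝ)
    (S : Set (Fin N × Fin N)) : Matrix ↥Sᶜ ↥S ℝ :=
  fun p q => kron Sig Sig p.val q.val

/-- `κ_Γ̄ := |||(Γ̄_{SS})⁻¹|||_∞`. -/
noncomputable def kappaGamma {N : ℕ} (Sig : Matrix (Fin N) (Fin N) ℝ)
    (S : Set (Fin N × Fin N)) : ℝ :=
  opInf (gammaSS Sig S)⁻¹

/-- Mutual incoherence (Assumption 1): `|||Γ̄_{S^cS}(Γ̄_{SS})⁻¹|||_∞ ≤ 1 − α`. -/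
noncomputable def MutualIncoherence {N : ℕ} (Sig : Matrix (Fin N) (Fin N) ℝ)
    (S : Set (Fin N × Fin N)) (α : ℝ) : Prop :=
  opInf (gammaScS Sig S * (gammaSS Sig S)⁻¹) ≤ 1 - α

/-- Maximal row-support size (degree) of a matrix. -/
noncomputable def matDegree {N : ℕ} (A : Matrix (Fin N) (Fin N) ℝ) : ℕ :=
  Finset.sup Finset.univ fun i => (Finset.univ.filter fun j => A i j ≠ 0).card

theorem abs_le_elemInf {N : ℕ} (A : Matrix (Fin N) (Fin N) ℝ) (p : Fin N × Fin N) :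
    |A p.1 p.2| ≤ elemInf A :=
  le_ciSup (f := fun p : Fin N × Fin N => |A p.1 p.2|) (Set.finite_range _).bddAbove p

theorem abs_mulVec_le {m n : Type*} [Finite m] [Fintype n] (A : Matrix m n ℝ) (v : n → ℝ)
    {c : ℝ} (hv : ∀ j, |v j| ≤ c) (hc : 0 ≤ c) (i : m) : |(A *ᵥ v) i| ≤ opInf A * c := by
  have hrow : ∑ j, |A i j| ≤ opInf A :=
    le_ciSup (f := fun i => ∑ j, |A i j|) (Set.finite_range _).bddAbove i
  calc |(A *ᵥ v) i| ≤ ∑ j, |A i j * v j| := Finset.abs_sum_le_sum_abs _ _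
    _ ≤ ∑ j, |A i j| * c := by
      refine Finset.sum_le_sum fun j _ => ?_
      rw [abs_mul]
      exact mul_le_mul_of_nonneg_left (hv j) (abs_nonneg _)
    _ = (∑ j, |A i j|) * c := (Finset.sum_mul _ _ _).symm
    _ ≤ opInf A * c := mul_le_mul_of_nonneg_right hrow hc

theorem posDef_gammaSS {N : ℕ} {Sig : Matrix (Fin N) (Fin N) ℝ} (hSig : Sig.PosDef)
    (S : Set (Fin N × Fin N)) : (gammaSS Sig S).PosDef :=
  (hSig.kronecker hSig).submatrix Subtype.val_injective

/-- The entries of `Σ Ψ Σ` are those of `(Σ ⊗ Σ) vec Ψ`, restricted to a set outside which `Ψ`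
vanishes. -/
theorem mul_mul_apply_eq_sum_kron {N : ℕ} {Sig Psi : Matrix (Fin N) (Fin N) ℝ}
    (hSig : Sig.IsSymm) {S : Set (Fin N × Fin N)}
    (hPsi : ∀ p : Fin N × Fin N, p ∉ S → Psi p.1 p.2 = 0) (p : Fin N × Fin N) :
    (Sig * Psi * Sig) p.1 p.2 = ∑ q : S, kron Sig Sig p q * Psi q.1.1 q.1.2 := by
  have hsub : ∑ q : S, kron Sig Sig p q * Psi q.1.1 q.1.2 =
      ∑ q : Fin N × Fin N, kron Sig Sig p q * Psi q.1 q.2 := by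
    rw [← Fintype.sum_subtype_add_sum_subtype (· ∈ S)]
    refine (add_eq_left.mpr (Finset.sum_eq_zero fun q _ => ?_)).symm
    rw [hPsi q.1 q.2, mul_zero]
  rw [hsub, Fintype.sum_prod_type, Finset.sum_comm]
  simp only [Matrix.mul_apply, Finset.sum_mul, kron]
  refine Finset.sum_congr rfl fun l _ => Finset.sum_congr rfl fun k _ => ?_
  rw [hSig.apply l p.2]
  ring

/-- strict dual feasibility. Under mutual incoherence, if the remainder term and
the noise term are both bounded by `αλ/8`, then the dual variable `Z̃` satisfies
`‖Z̃_{S^c}‖_∞ ≤ 1 − α/2 < 1`. -/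
theorem stmt2 {N K : ℕ}
    -- the true common precision matrix and its support
    (Ωb : Matrix (Fin N) (Fin N) ℝ) (hΩb : Ωb.PosDef)
    -- the fixed symmetric matrices Σ̂^{(k)} and the positive weights T^{(k)}
    (Sighat : Fin K → Matrix (Fin N) (Fin N) ℝ) (hSighat : ∀ k, (Sighat k).IsHermitian)
    (T : Fin K → ℝ) (hT : ∀ k, 0 < T k)
    (lam : ℝ) (hlam : 0 < lam)
    -- Assumption 1 (mutual incoherence) with constant α ∈ (0,1]
    (α : ℝ) (hα : α ∈ Set.Ioc (0 : ℝ) 1)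
    (hinc : MutualIncoherence Ωb⁻¹ (matSupp Ωb) α)
    -- Ω̃ is the restricted estimator: positive definite, supported on S, and minimizing the
    -- restricted ℓ₁-regularized problem among such matrices
    (Ωt : Matrix (Fin N) (Fin N) ℝ) (hΩtPD : Ωt.PosDef)
    (hΩtsupp : ∀ p : Fin N × Fin N, p ∉ matSupp Ωb → Ωt p.1 p.2 = 0)
    (hΩtmin : ∀ M : Matrix (Fin N) (Fin N) ℝ, M.PosDef →
      (∀ p : Fin N × Fin N, p ∉ matSupp Ωb → M p.1 p.2 = 0) →
      (∑ k, T k * (frobInner (Sighat k) Ωt - Real.log Ωt.det)) + lam * matL1Norm Ωt ≤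
        (∑ k, T k * (frobInner (Sighat k) M - Real.log M.det)) + lam * matL1Norm M)
    -- Z̃ satisfies the stationarity equation and `‖Z̃_S‖_∞ ≤ 1`
    (Zt : Matrix (Fin N) (Fin N) ℝ)
    (hstat : (∑ k, T k • (Sighat k - Ωt⁻¹)) + lam • Zt = 0)
    (hZS : ∀ p : Fin N × Fin N, p ∈ matSupp Ωb → |Zt p.1 p.2| ≤ 1)
    -- the two bounds: `T‖R(Ψ)‖_∞ ≤ αλ/8` with `R(Ψ) = Ω̃⁻¹ − Σ̄ + Σ̄ΨΣ̄`, `Ψ = Ω̃ − Ω̄`,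
    -- and `‖∑_k T^{(k)} W^{(k)}‖_∞ ≤ αλ/8` with `W^{(k)} = Σ̂^{(k)} − Σ̄`
    (hR : (∑ k, T k) *
      elemInf (Ωt⁻¹ - Ωb⁻¹ + Ωb⁻¹ * (Ωt - Ωb) * Ωb⁻¹) ≤ α * lam / 8)
    (hW : elemInf (∑ k, T k • (Sighat k - Ωb⁻¹)) ≤ α * lam / 8) :
    -- strict dual feasibility
    (∀ p : Fin N × Fin N, p ∉ matSupp Ωb → |Zt p.1 p.2| ≤ 1 - α / 2) ∧ 1 - α / 2 < 1 := by
  obtain ⟨hα0, hα1⟩ := hα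
  refine ⟨fun p hp => ?_, by linarith⟩
  set S := matSupp Ωb
  set t := ∑ k, T k
  set R := Ωt⁻¹ - Ωb⁻¹ + Ωb⁻¹ * (Ωt - Ωb) * Ωb⁻¹ with hRdef
  set W := ∑ k, T k • (Sighat k - Ωb⁻¹) with hWdef
  have ht : 0 ≤ t := Finset.sum_nonneg fun k _ => (hT k).le
  have hSig : (Ωb⁻¹).PosDef := hΩb.inv
  have hSymm : (Ωb⁻¹).IsSymm := by simpa [Matrix.IsHermitian, Matrix.IsSymm] using hSig.isHermitian
  have hPsi : ∀ q : Fin N × Fin N, q ∉ S → (Ωt - Ωb) q.1 q.2 = 0 := by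
    intro q hq
    have hb : Ωb q.1 q.2 = 0 := not_not.mp hq
    simp [hΩtsupp q hq, hb]
  have hmat : t • (Ωb⁻¹ * (Ωt - Ωb) * Ωb⁻¹) = t • R - W - lam • Zt := by
    have hsplit : ∑ k, T k • (Sighat k - Ωt⁻¹) = W - t • (Ωt⁻¹ - Ωb⁻¹) := by
      rw [hWdef, Finset.sum_smul, ← Finset.sum_sub_distrib]
      refine Finset.sum_congr rfl fun k _ => ?_
      rw [← smul_sub]
      congr 1
      abel
    have hZ : lam • Zt = t • (Ωt⁻¹ - Ωb⁻¹) - W := by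
      rw [hsplit] at hstat
      rw [eq_sub_iff_add_eq, ← sub_eq_zero, ← hstat]
      abel
    rw [hZ, hRdef, smul_add]
    abel
  have hent : ∀ q : Fin N × Fin N,
      t * ∑ r : S, kron Ωb⁻¹ Ωb⁻¹ q r * (Ωt - Ωb) r.1.1 r.1.2 =
        t * R q.1 q.2 - W q.1 q.2 - lam * Zt q.1 q.2 := by
    intro q
    rw [← mul_mul_apply_eq_sum_kron hSymm hPsi]
    simpa using congrFun (congrFun hmat q.1) q.2
  have hRW : ∀ q : Fin N × Fin N, |t * R q.1 q.2 - W q.1 q.2| ≤ α * lam / 4 := by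
    intro q
    have h1 : |t * R q.1 q.2| ≤ α * lam / 8 := by
      rw [abs_mul, abs_of_nonneg ht]
      exact (mul_le_mul_of_nonneg_left (abs_le_elemInf R q) ht).trans hR
    have h2 := (abs_le_elemInf W q).trans hW
    linarith [abs_sub (t * R q.1 q.2) (W q.1 q.2)]
  let u : S → ℝ := fun r => t * (Ωt - Ωb) r.1.1 r.1.2
  have hsum : ∀ q : Fin N × Fin N, ∑ r : S, kron Ωb⁻¹ Ωb⁻¹ q r * u r =
      t * R q.1 q.2 - W q.1 q.2 - lam * Zt q.1 q.2 := by
    intro q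
    rw [← hent q, Finset.mul_sum]
    exact Finset.sum_congr rfl fun r _ => mul_left_comm _ _ _
  have hv : ∀ r : S, |(gammaSS Ωb⁻¹ S *ᵥ u) r| ≤ α * lam / 4 + lam := by
    intro r
    have h0 : (gammaSS Ωb⁻¹ S *ᵥ u) r = _ := hsum r
    have h1 : |lam * Zt r.1.1 r.1.2| ≤ lam := by
      rw [abs_mul, abs_of_pos hlam]
      exact mul_le_of_le_one_right hlam.le (hZS r r.2)
    rw [h0]
    exact (abs_sub _ _).trans (add_le_add (hRW r) h1)
  have hc : 0 ≤ α * lam / 4 + lam := by positivity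
  have hdet : IsUnit (gammaSS Ωb⁻¹ S).det :=
    (posDef_gammaSS hSig S).det_pos.ne'.isUnit
  have hM := abs_mulVec_le (gammaScS Ωb⁻¹ S * (gammaSS Ωb⁻¹ S)⁻¹) _ hv hc ⟨p, hp⟩
  rw [Matrix.mulVec_mulVec, Matrix.mul_assoc, Matrix.nonsing_inv_mul _ hdet,
    Matrix.mul_one] at hM
  have h0 : (gammaScS Ωb⁻¹ S *ᵥ u) ⟨p, hp⟩ = _ := hsum p
  rw [h0] at hM
  have hM' := hM.trans (mul_le_mul_of_nonneg_right hinc hc)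
  have hZ : lam * |Zt p.1 p.2| ≤ α * lam / 4 + (1 - α) * (α * lam / 4 + lam) := by
    have hq := hRW p
    rw [← abs_of_pos hlam, ← abs_mul, abs_of_pos hlam]
    rw [abs_le] at hM' hq ⊢
    constructor <;> linarith
  refine le_of_mul_le_mul_left (hZ.trans ?_) hlam
  nlinarith [mul_nonneg (sq_nonneg α) hlam.le]
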